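/- Let x and y be positive integers with y odd and gcd(x, y) = 1. Then D(2x + y, 2x − y; 2xy) = 1/(12xy) + y/(6x) − 1/4 − 2·s(y, x). -/

import Mathlib

/-- The sawtooth function `((t))`: it is `t - ⌊t⌋ - 1/2` for `t ∉ ℤ` and `0` for `t ∈ ℤ`. -/
noncomputable def sawtooth (t : ℝ) : ℝ :=
  if Int.fract t = 0 then 0 else Int.fract t - 1 / 2

/-- The Dedekind sum `D(a, b; c) = ∑_{i=1}^{c-1} ((a i / c)) ((b i / c))`. -/
noncomputable def dedekindD (a b : ℤ) (c : ℕ) : ℝ :=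
  ∑ i ∈ Finset.Ico 1 c, sawtooth ((a : ℝ) * i / c) * sawtooth ((b : ℝ) * i / c)

/-- The classical two-argument Dedekind sum `s(b, c) = D(1, b; c)`. -/
noncomputable def dedekindS (b : ℤ) (c : ℕ) : ℝ := dedekindD 1 b c

theorem sawtooth_add_int (t : ℝ) (k : ℤ) : sawtooth (t + k) = sawtooth t := by
  simp [sawtooth]

theorem sawtooth_zero : sawtooth 0 = 0 := by simp [sawtooth]

theorem sawtooth_intCast (k : ℤ) : sawtooth k = 0 := by simp [sawtooth]

theorem sawtooth_of_pos_of_lt_one {t : ℝ} (h0 : 0 < t) (h1 : t < 1) : sawtooth t = t - 1 / 2 := by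
  rw [sawtooth, Int.fract_eq_self.2 ⟨h0.le, h1⟩, if_neg h0.ne']

theorem sawtooth_neg (t : ℝ) : sawtooth (-t) = -sawtooth t := by
  unfold sawtooth
  by_cases h : Int.fract t = 0
  · simp [h, Int.fract_neg_eq_zero.2 h]
  · rw [if_neg h, if_neg (mt Int.fract_neg_eq_zero.1 h), Int.fract_neg h]
    ring

/-- The square of the sawtooth cocycle at three numbers that are not integers. -/
theorem sawtooth_sub_sub_sq {a b : ℝ} (ha : Int.fract a ≠ 0) (hb : Int.fract b ≠ 0)
    (hab : Int.fract (a - b) ≠ 0) :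
    (sawtooth a - sawtooth b - sawtooth (a - b)) ^ 2 = 1 / 4 := by
  rw [sawtooth, sawtooth, sawtooth, if_neg ha, if_neg hb, if_neg hab]
  have h0 := Int.fract_nonneg a
  have h1 := Int.fract_lt_one a
  have h2 := Int.fract_nonneg b
  have h3 := Int.fract_lt_one b
  rcases le_or_gt (Int.fract b) (Int.fract a) with h | h
  · have : Int.fract (a - b) = Int.fract a - Int.fract b := by
      rw [Int.fract_eq_iff]
      refine ⟨by linarith, by linarith, ⌊a⌋ - ⌊b⌋, ?_⟩
      push_cast
      linarith [Int.self_sub_floor a, Int.self_sub_floor b]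
    rw [this]; ring
  · have : Int.fract (a - b) = Int.fract a - Int.fract b + 1 := by
      rw [Int.fract_eq_iff]
      refine ⟨by linarith, by linarith, ⌊a⌋ - ⌊b⌋ - 1, ?_⟩
      push_cast
      linarith [Int.self_sub_floor a, Int.self_sub_floor b]
    rw [this]; ring

/-- A sum over a full period is invariant under invertible affine substitutions. -/
theorem sum_range_periodic_affine {n : ℕ} (hn : 0 < n) {g : ℤ → ℝ}
    (hg : Function.Periodic g n) {a : ℤ} (ha : IsCoprime a n) (b : ℤ) :
    ∑ i ∈ Finset.range n, g (a * i + b) = ∑ i ∈ Finset.range n, g i := by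
  have : NeZero n := ⟨hn.ne'⟩
  have key : ∀ i j : ℤ, (i : ZMod n) = j → g i = g j := by
    intro i j h
    obtain ⟨k, hk⟩ := (ZMod.intCast_eq_intCast_iff_dvd_sub i j n).1 h
    obtain rfl : j = i + k * n := by linarith
    exact (hg.int_mul k i).symm
  have hsum : ∀ h : ℕ → ℝ, ∑ i ∈ Finset.range n, h i = ∑ z : ZMod n, h z.val := by
    intro h
    refine Finset.sum_bij' (fun i _ => (i : ZMod n)) (fun z _ => z.val) ?_ ?_ ?_ ?_ ?_
    · simp
    · intro z _; simpa using z.val_lt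
    · intro i hi; exact ZMod.val_cast_of_lt (Finset.mem_range.1 hi)
    · simp
    · intro i hi; rw [ZMod.val_cast_of_lt (Finset.mem_range.1 hi)]
  rw [hsum, hsum fun i => g i]
  obtain ⟨u, v, huv⟩ := ha
  have hu : (u : ZMod n) * a = 1 := by
    have := congrArg (Int.cast : ℤ → ZMod n) huv
    simpa using this
  have hbij : Function.Bijective fun z : ZMod n => (a : ZMod n) * z + b := by
    rw [← Finite.injective_iff_bijective]
    intro z w hzw
    have h : (a : ZMod n) * z = a * w := add_right_cancel hzw
    calc z = u * a * z := by rw [hu, one_mul]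
      _ = u * a * w := by rw [mul_assoc, h, mul_assoc]
      _ = w := by rw [hu, one_mul]
  rw [← hbij.sum_comp fun z => g z.val]
  refine Finset.sum_congr rfl fun z _ => key _ _ ?_
  simp

theorem sum_range_mul {M : Type*} [AddCommMonoid M] (g : ℕ → M) (x k : ℕ) :
    ∑ i ∈ Finset.range (x * k), g i
      = ∑ r ∈ Finset.range x, ∑ m ∈ Finset.range k, g (r + x * m) := by
  induction k with
  | zero => simp
  | succ k ih =>
    rw [Nat.mul_succ, Finset.sum_range_add, ih, ← Finset.sum_add_distrib]
    refine Finset.sum_congr rfl fun r _ => ?_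
    rw [Finset.sum_range_succ, add_comm r]

theorem sum_range_natCast (n : ℕ) :
    ∑ i ∈ Finset.range n, (i : ℝ) = (n : ℝ) * (n - 1) / 2 := by
  induction n with
  | zero => simp
  | succ n ih => rw [Finset.sum_range_succ, ih]; push_cast; ring

theorem sum_range_natCast_sq (n : ℕ) :
    ∑ i ∈ Finset.range n, (i : ℝ) ^ 2 = (n : ℝ) * (n - 1) * (2 * n - 1) / 6 := by
  induction n with
  | zero => simp
  | succ n ih => rw [Finset.sum_range_succ, ih]; push_cast; ring

theorem sawtooth_natCast_div {i n : ℕ} (hi : 0 < i) (hin : i < n) :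
    sawtooth ((i : ℝ) / n) = (i : ℝ) / n - 1 / 2 := by
  have hn : (0 : ℝ) < n := by exact_mod_cast hi.trans hin
  apply sawtooth_of_pos_of_lt_one
  · have : (0 : ℝ) < i := by exact_mod_cast hi
    positivity
  · rw [div_lt_one hn]; exact_mod_cast hin

theorem sum_sawtooth_sq {n : ℕ} (hn : 0 < n) :
    ∑ i ∈ Finset.range n, sawtooth ((i : ℝ) / n) ^ 2 = ((n : ℝ) - 1) * (n - 2) / (12 * n) := by
  have hn' : (n : ℝ) ≠ 0 := by positivity
  have h : ∀ i ∈ Finset.range n, sawtooth ((i : ℝ) / n) ^ 2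
      = (i : ℝ) ^ 2 * (1 / n ^ 2) - i * (1 / n) + 1 / 4 - if i = 0 then 1 / 4 else 0 := by
    intro i hi
    rcases Nat.eq_zero_or_pos i with rfl | h
    · simp [sawtooth_zero]
    · rw [sawtooth_natCast_div h (Finset.mem_range.1 hi), if_neg h.ne']
      field_simp
      ring
  rw [Finset.sum_congr rfl h, Finset.sum_sub_distrib, Finset.sum_add_distrib,
    Finset.sum_sub_distrib, ← Finset.sum_mul, ← Finset.sum_mul, sum_range_natCast,
    sum_range_natCast_sq, Finset.sum_ite_eq']
  simp only [Finset.mem_range, hn, if_true, Finset.sum_const, Finset.card_range, nsmul_eq_mul]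
  field_simp
  ring

/-- The distribution relation of the sawtooth function. -/
theorem sum_sawtooth_add_mul_div {n : ℕ} (hn : 0 < n) {a : ℤ} (ha : IsCoprime a n) (t : ℝ) :
    ∑ m ∈ Finset.range n, sawtooth (t + a * m / n) = sawtooth (n * t) := by
  have hn' : (0 : ℝ) < n := by exact_mod_cast hn
  set s : ℝ := Int.fract (n * t) with hs
  have ht : t = s / n + (⌊(n : ℝ) * t⌋ : ℤ) / n := by
    rw [← add_div, hs, Int.fract_add_floor]; field_simp
  have hper : Function.Periodic (fun i : ℤ => sawtooth (s / n + i / n)) n := by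
    intro i
    have : s / n + ((i + n : ℤ) : ℝ) / n = s / n + i / n + (1 : ℤ) := by
      push_cast; field_simp; ring
    simp only [this, sawtooth_add_int]
  have h := sum_range_periodic_affine hn hper ha ⌊(n : ℝ) * t⌋
  have h' : ∀ m ∈ Finset.range n, sawtooth (t + a * m / n)
      = sawtooth (s / n + ((a * m + ⌊(n : ℝ) * t⌋ : ℤ) : ℝ) / n) := by
    intro m _
    congr 1
    nth_rewrite 1 [ht]
    push_cast
    ring
  rw [Finset.sum_congr rfl h', h]
  have hs0 : 0 ≤ s := Int.fract_nonneg _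
  have hs1 : s < 1 := Int.fract_lt_one _
  have hval : ∀ m ∈ Finset.range n, sawtooth (s / n + ((m : ℤ) : ℝ) / n)
      = (m : ℝ) * (1 / n) + (s / n - 1 / 2)
        + if m = 0 then (if s = 0 then 1 / 2 else 0) else 0 := by
    intro m hm
    have hm1 : (m : ℝ) + 1 ≤ n := by exact_mod_cast Finset.mem_range.1 hm
    by_cases h0 : s + m = 0
    · have hm0 : (0 : ℝ) ≤ m := by positivity
      have hs' : s = 0 := by linarith
      have hm' : m = 0 := by
        have : (m : ℝ) = 0 := by linarith
        exact_mod_cast this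
      simp [hm', hs', sawtooth_zero]
    · have hpos : 0 < s + m := lt_of_le_of_ne (by positivity) (Ne.symm h0)
      have hif : (if m = 0 then (if s = 0 then (1 / 2 : ℝ) else 0) else 0) = 0 := by
        split_ifs with h1 h2
        · simp [h1, h2] at h0
        · rfl
        · rfl
      rw [hif, Int.cast_natCast, ← add_div, sawtooth_of_pos_of_lt_one (by positivity)
        (by rw [div_lt_one hn']; linarith)]
      ring
  rw [Finset.sum_congr rfl hval, Finset.sum_add_distrib, Finset.sum_add_distrib, ← Finset.sum_mul,
    sum_range_natCast, Finset.sum_ite_eq', sawtooth, ← hs]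
  simp only [Finset.mem_range, hn, if_true, Finset.sum_const, Finset.card_range, nsmul_eq_mul]
  split_ifs with h0
  · rw [h0]; field_simp; ring
  · field_simp; ring

theorem dedekindD_eq_sum_range (a b : ℤ) (c : ℕ) :
    dedekindD a b c
      = ∑ i ∈ Finset.range c, sawtooth ((a : ℝ) * i / c) * sawtooth ((b : ℝ) * i / c) := by
  rcases Nat.eq_zero_or_pos c with rfl | hc
  · simp [dedekindD]
  · rw [dedekindD, Finset.range_eq_Ico, Finset.sum_eq_sum_Ico_succ_bot hc]
    simp [sawtooth_zero]

theorem sum_sawtooth_mul_div_sq {n : ℕ} (hn : 0 < n) {a : ℤ} (ha : IsCoprime a n) :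
    ∑ i ∈ Finset.range n, sawtooth ((a : ℝ) * i / n) ^ 2
      = ((n : ℝ) - 1) * (n - 2) / (12 * n) := by
  have hn' : (n : ℝ) ≠ 0 := by positivity
  have hper : Function.Periodic (fun i : ℤ => sawtooth ((i : ℝ) / n) ^ 2) n := by
    intro i
    have : ((i + n : ℤ) : ℝ) / n = i / n + (1 : ℤ) := by
      push_cast; field_simp
    simp only [this, sawtooth_add_int]
  rw [← sum_sawtooth_sq hn]
  simpa using sum_range_periodic_affine hn hper ha 0

theorem sum_sawtooth_mul_sawtooth {x k : ℕ} (hx : 0 < x) (hk : 0 < k) {a : ℤ}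
    (ha : IsCoprime a k) :
    ∑ i ∈ Finset.range (x * k), sawtooth ((a : ℝ) * i / (x * k : ℕ)) * sawtooth ((i : ℝ) / x)
      = dedekindS a x := by
  have hx' : (x : ℝ) ≠ 0 := by positivity
  have hk' : (k : ℝ) ≠ 0 := by positivity
  rw [sum_range_mul, dedekindS, dedekindD_eq_sum_range]
  refine Finset.sum_congr rfl fun r _ => ?_
  have h : ∀ m ∈ Finset.range k,
      sawtooth ((a : ℝ) * (r + x * m : ℕ) / (x * k : ℕ)) * sawtooth (((r + x * m : ℕ) : ℝ) / x)
        = sawtooth ((a : ℝ) * r / (x * k) + a * m / k) * sawtooth ((r : ℝ) / x) := by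
    intro m _
    congr 1
    · congr 1; push_cast; field_simp
    · rw [← sawtooth_add_int ((r : ℝ) / x) m]
      congr 1; push_cast; field_simp
  rw [Finset.sum_congr rfl h, ← Finset.sum_mul, sum_sawtooth_add_mul_div hk ha, mul_comm]
  congr 2
  · simp
  · field_simp

theorem dedekindS_add_mul_self (b k : ℤ) (c : ℕ) : dedekindS (b + k * c) c = dedekindS b c := by
  unfold dedekindS dedekindD
  refine Finset.sum_congr rfl fun i hi => ?_
  have hc : (c : ℝ) ≠ 0 := by
    have := Finset.mem_Ico.1 hi
    have : c ≠ 0 := by omega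
    exact_mod_cast this
  congr 1
  rw [← sawtooth_add_int ((b : ℝ) * i / c) (k * i)]
  congr 1
  push_cast
  field_simp

theorem dedekindS_neg (b : ℤ) (c : ℕ) : dedekindS (-b) c = -dedekindS b c := by
  rw [dedekindS, dedekindS, dedekindD, dedekindD, ← Finset.sum_neg_distrib]
  refine Finset.sum_congr rfl fun i _ => ?_
  rw [Int.cast_neg, neg_mul, neg_div, sawtooth_neg, mul_neg]

theorem fract_intCast_div_ne_zero {i : ℤ} {n : ℕ} (hn : 0 < n) (h : ¬ (n : ℤ) ∣ i) :
    Int.fract ((i : ℝ) / n) ≠ 0 := by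
  have hn' : (n : ℝ) ≠ 0 := by positivity
  rw [Ne, Int.fract_eq_zero_iff]
  rintro ⟨z, hz⟩
  rw [eq_div_iff hn'] at hz
  exact h ⟨z, by rw [mul_comm]; exact_mod_cast hz.symm⟩

theorem sum_ite_dvd {x : ℕ} (hx : 0 < x) (k : ℕ) (q : ℝ) :
    ∑ i ∈ Finset.range (x * k), (if x ∣ i then 0 else q) = ((x : ℝ) - 1) * k * q := by
  rw [sum_range_mul]
  have h : ∀ r ∈ Finset.range x, ∑ m ∈ Finset.range k, (if x ∣ r + x * m then 0 else q)
      = k * q - if r = 0 then k * q else 0 := by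
    intro r hr
    have hr0 : x ∣ r ↔ r = 0 :=
      ⟨fun h => Nat.eq_zero_of_dvd_of_lt h (Finset.mem_range.1 hr), fun h => h ▸ dvd_zero x⟩
    simp only [Nat.dvd_add_left (dvd_mul_right x _), hr0]
    split_ifs <;> simp
  rw [Finset.sum_congr rfl h, Finset.sum_sub_distrib, Finset.sum_ite_eq']
  simp only [Finset.mem_range, hx, if_true, Finset.sum_const, Finset.card_range, nsmul_eq_mul]
  ring

/-- A reciprocity relation for numerators that differ by twice the cofactor of the modulus. -/
theorem dedekindD_reciprocity {x k : ℕ} (hx : 0 < x) (hk : 0 < k) {a b : ℤ}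
    (ha : IsCoprime a (x * k : ℕ)) (hb : IsCoprime b (x * k : ℕ)) (hab : a - b = k) :
    2 * dedekindD a b (x * k) + 2 * dedekindS a x - 2 * dedekindS b x
      = 2 * (((x : ℝ) * k - 1) * (x * k - 2) / (12 * (x * k)))
        + k * (((x : ℝ) - 1) * (x - 2) / (12 * x)) - ((x : ℝ) - 1) * k / 4 := by
  have hx' : (x : ℝ) ≠ 0 := by positivity
  have hk' : (k : ℝ) ≠ 0 := by positivity
  have hc : 0 < x * k := Nat.mul_pos hx hk
  have hak : IsCoprime a k := ha.of_isCoprime_of_dvd_right ⟨x, by push_cast; ring⟩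
  have hbk : IsCoprime b k := hb.of_isCoprime_of_dvd_right ⟨x, by push_cast; ring⟩
  have hab' : (a : ℝ) - b = k := by exact_mod_cast hab
  have hsub : ∀ i : ℕ, (a : ℝ) * i / (x * k : ℕ) - b * i / (x * k : ℕ) = i / x := by
    intro i
    rw [← sub_div, ← sub_mul, hab']
    push_cast
    field_simp
  have hpt : ∀ i ∈ Finset.range (x * k),
      (sawtooth ((a : ℝ) * i / (x * k : ℕ)) - sawtooth ((b : ℝ) * i / (x * k : ℕ))
        - sawtooth ((i : ℝ) / x)) ^ 2 = if x ∣ i then 0 else 1 / 4 := by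
    intro i hi
    split_ifs with h
    · obtain ⟨m, rfl⟩ := h
      have h1 : ((x * m : ℕ) : ℝ) / x = (m : ℤ) := by push_cast; field_simp
      have h2 := hsub (x * m)
      rw [h1, sub_eq_iff_eq_add'] at h2
      rw [h1, sawtooth_intCast, h2, sawtooth_add_int]
      ring
    · have hnd : ¬ ((x * k : ℕ) : ℤ) ∣ (i : ℤ) := by
        rw [Int.natCast_dvd_natCast]
        exact fun hd => h ((dvd_mul_right x k).trans hd)
      have hfr : ∀ e : ℤ, IsCoprime e (x * k : ℕ) →
          Int.fract ((e : ℝ) * i / (x * k : ℕ)) ≠ 0 := by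
        intro e he
        have := fract_intCast_div_ne_zero (i := e * i) hc
          fun hd => hnd (he.symm.dvd_of_dvd_mul_left hd)
        exact_mod_cast this
      have hx0 := fract_intCast_div_ne_zero (i := (i : ℤ)) hx
        (by rwa [Int.natCast_dvd_natCast])
      rw [Int.cast_natCast, ← hsub i] at hx0
      rw [← hsub i]
      exact sawtooth_sub_sub_sq (hfr a ha) (hfr b hb) hx0
  have hsq : ∑ i ∈ Finset.range (x * k), sawtooth ((i : ℝ) / x) ^ 2
      = k * (((x : ℝ) - 1) * (x - 2) / (12 * x)) := by
    rw [sum_range_mul, ← sum_sawtooth_sq hx, Finset.mul_sum]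
    refine Finset.sum_congr rfl fun r _ => ?_
    have h : ∀ m ∈ Finset.range k, sawtooth (((r + x * m : ℕ) : ℝ) / x) ^ 2
        = sawtooth ((r : ℝ) / x) ^ 2 := by
      intro m _
      rw [← sawtooth_add_int ((r : ℝ) / x) m]
      congr 2; push_cast; field_simp
    rw [Finset.sum_congr rfl h]
    simp
  have hexp : ∀ p q r : ℝ, (p - q - r) ^ 2
      = p ^ 2 + q ^ 2 + r ^ 2 - 2 * (p * q) - 2 * (p * r) + 2 * (q * r) := by
    intro p q r; ring
  have htot := Finset.sum_congr rfl hpt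
  simp only [hexp] at htot
  rw [sum_ite_dvd hx] at htot
  simp only [Finset.sum_add_distrib, Finset.sum_sub_distrib, ← Finset.mul_sum] at htot
  rw [sum_sawtooth_mul_div_sq hc ha, sum_sawtooth_mul_div_sq hc hb, hsq,
    sum_sawtooth_mul_sawtooth hx hk hak, sum_sawtooth_mul_sawtooth hx hk hbk,
    ← dedekindD_eq_sum_range] at htot
  push_cast at htot
  linarith

/-- For positive integers `x, y` with `y` odd and `gcd(x, y) = 1`,
`D(2x + y, 2x − y; 2xy) = 1/(12xy) + y/(6x) − 1/4 − 2 s(y, x)`. -/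
theorem stmt_15 (x y : ℕ) (hx : 0 < x) (hy : 0 < y) (hodd : Odd y)
    (hgcd : Nat.gcd x y = 1) :
    dedekindD (2 * (x : ℤ) + y) (2 * (x : ℤ) - y) (2 * x * y)
      = 1 / (12 * (x : ℝ) * y) + (y : ℝ) / (6 * x) - 1 / 4 - 2 * dedekindS (y : ℤ) x := by
  have hx' : (x : ℝ) ≠ 0 := by positivity
  have hy' : (y : ℝ) ≠ 0 := by positivity
  have hxy : IsCoprime (x : ℤ) y := Nat.isCoprime_iff_coprime.2 hgcd
  have h2y : IsCoprime (2 : ℤ) y := by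
    exact_mod_cast Nat.isCoprime_iff_coprime.2 hodd.coprime_two_left
  have h2xy : IsCoprime (2 * (x : ℤ)) y := h2y.mul_left hxy
  have hcop : ∀ e : ℤ, IsCoprime (2 * (x : ℤ)) e → IsCoprime (y : ℤ) e →
      IsCoprime e (x * (2 * y) : ℕ) := by
    intro e h1 h2
    have := (h1.mul_left h2).symm
    push_cast
    rwa [show (x : ℤ) * (2 * y) = 2 * x * y by ring]
  have ha : IsCoprime (2 * (x : ℤ) + y) (x * (2 * y) : ℕ) :=
    hcop _ (by simpa [add_comm] using IsCoprime.add_mul_left_right h2xy 1)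
      (by simpa using IsCoprime.add_mul_left_right h2xy.symm 1)
  have hb : IsCoprime (2 * (x : ℤ) - y) (x * (2 * y) : ℕ) := by
    refine hcop _ ?_ ?_
    · have := IsCoprime.add_mul_left_right h2xy.neg_right 1
      rwa [show -(y : ℤ) + 2 * x * 1 = 2 * x - y by ring] at this
    · have := IsCoprime.add_mul_left_right h2xy.symm (-1)
      rwa [show 2 * (x : ℤ) + y * (-1) = 2 * x - y by ring] at this
  have key := dedekindD_reciprocity hx (by omega : 0 < 2 * y) ha hb (by push_cast; ring)
  rw [show 2 * (x : ℤ) + y = y + 2 * x by ring, dedekindS_add_mul_self,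
    show 2 * (x : ℤ) - y = -y + 2 * x by ring, dedekindS_add_mul_self, dedekindS_neg,
    show x * (2 * y) = 2 * x * y by ring] at key
  rw [show 2 * (x : ℤ) + y = y + 2 * x by ring, show 2 * (x : ℤ) - y = -y + 2 * x by ring]
  push_cast at key
  have hrat : 2 * (((x : ℝ) * (2 * y) - 1) * (x * (2 * y) - 2) / (12 * (x * (2 * y))))
        + 2 * y * (((x : ℝ) - 1) * (x - 2) / (12 * x)) - ((x : ℝ) - 1) * (2 * y) / 4
      = 2 * (1 / (12 * (x : ℝ) * y) + (y : ℝ) / (6 * x) - 1 / 4) := by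
    field_simp
    ring
  linarith
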